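/- arXiv:2111.07930 — 3 statements merged into one kernel-verified Lean document; each statement's English description precedes it below -/
import Mathlib

section
/- If G is a surjunctive group and k is any field, then the group ring k[G] is directly finite: for a, b ∈ k[G], ab = 1 implies ba = 1. -/
/-- A cellular automaton over group `G` and alphabet `A`. -/
def IsCellularAutomaton (G : Type) [Group G] (A : Type) (τ : (G → A) → (G → A)) : Prop :=
  ∃ (M : Finset G) (μ : (M → A) → A), ∀ (c : G → A) (g : G),
    τ c g = μ fun m : M => c (g * (m : G))

/-- A group is surjunctive if every injective cellular automaton with finite
alphabet over it is surjective. -/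
def Surjunctive (G : Type) [Group G] : Prop :=
  ∀ (A : Type) [Finite A] (τ : (G → A) → (G → A)),
    IsCellularAutomaton G A τ → Function.Injective τ → Function.Surjective τ

/-- The right translation action of a monoid algebra on the functions `G → R`. -/
noncomputable def MonoidAlgebra.translationAction (R G : Type*) [CommRing R] [Monoid G] :
    MonoidAlgebra R G →ₐ[R] Module.End R (G → R) :=
  MonoidAlgebra.lift R (Module.End R (G → R)) G
    { toFun := fun h => LinearMap.funLeft R R (· * h)
      map_one' := by ext; simp [LinearMap.funLeft]
      map_mul' := fun h h' => by
        ext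
        simp [LinearMap.funLeft, mul_assoc] }

theorem MonoidAlgebra.translationAction_apply {R G : Type*} [CommRing R] [Monoid G]
    (x : MonoidAlgebra R G) (c : G → R) (g : G) :
    translationAction R G x c g = ∑ m ∈ x.coeff.support, x.coeff m * c (g * m) := by
  simp [translationAction, MonoidAlgebra.lift_apply, Finsupp.sum, LinearMap.funLeft]

theorem MonoidAlgebra.translationAction_injective (R G : Type*) [CommRing R] [Monoid G] :
    Function.Injective (translationAction R G) := by
  classical
  rw [injective_iff_map_eq_zero]
  intro x hx
  ext g
  have h := congrFun (LinearMap.congr_fun hx (Pi.single g 1)) 1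
  simpa [translationAction_apply, Pi.single_apply] using h

theorem isCellularAutomaton_translationAction {G R : Type} [Group G] [CommRing R]
    (x : MonoidAlgebra R G) :
    IsCellularAutomaton G R (MonoidAlgebra.translationAction R G x) := by
  refine ⟨x.coeff.support, fun f => ∑ m : x.coeff.support, x.coeff m * f m, fun c g => ?_⟩
  rw [MonoidAlgebra.translationAction_apply]
  exact (Finset.sum_coe_sort x.coeff.support fun m => x.coeff m * c (g * m)).symm

theorem Surjunctive.mul_eq_one_symm_of_finite {G : Type} [Group G] (hG : Surjunctive G)
    {R : Type} [CommRing R] [Finite R] {a b : MonoidAlgebra R G} (h : a * b = 1) :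
    b * a = 1 := by
  set T := MonoidAlgebra.translationAction R G
  have hab : T a * T b = 1 := by rw [← map_mul, h, map_one]
  have hleft : Function.LeftInverse (T a) (T b) := fun c => LinearMap.congr_fun hab c
  have hsurj := hG R (T b) (isCellularAutomaton_translationAction b) hleft.injective
  have hright := hleft.rightInverse_of_surjective hsurj
  apply MonoidAlgebra.translationAction_injective R G
  rw [map_mul, map_one]
  exact LinearMap.ext hright

theorem Int.isJacobsonRing : IsJacobsonRing ℤ := by
  rw [isJacobsonRing_iff_prime_eq]
  intro P hP
  by_cases h : P = ⊥
  · subst h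
    refine le_antisymm (fun x hx => ?_) Ideal.le_jacobson
    rw [Ideal.mem_jacobson_bot] at hx
    have hsq := hx x
    rw [Int.isUnit_iff] at hsq
    rw [Ideal.mem_bot]
    rcases hsq with hsq | hsq <;> nlinarith
  · have := hP.isMaximal h
    exact Ideal.jacobson_eq_self_of_isMaximal

/-- A field of finite type over `ℤ` is finite. -/
theorem Field.finite_of_finiteType_int (K : Type*) [Field K] [alg : Algebra ℤ K]
    [Algebra.FiniteType ℤ K] :
    Finite K := by
  obtain rfl : alg = Ring.toIntAlgebra K := Subsingleton.elim _ _
  have := Int.isJacobsonRing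
  have := finite_of_finite_type_of_isJacobsonRing ℤ K
  obtain ⟨n, hn, hn0⟩ : ∃ n : ℤ, (n : K) = 0 ∧ n ≠ 0 := by
    by_contra! hinj
    refine Int.not_isField (isField_of_isIntegral_of_isField (R := ℤ) (S := K) ?_
      (Field.toIsField K))
    rw [injective_iff_map_eq_zero]
    exact fun n hn => hinj n (by simpa using hn)
  refine Module.finite_of_fg_torsion K fun x => ⟨⟨n, mem_nonZeroDivisors_of_ne_zero hn0⟩, ?_⟩
  change n • x = 0
  rw [zsmul_eq_mul, hn, zero_mul]

theorem MonoidAlgebra.exists_mapRingHom_subtype_eq {k G : Type*} [CommRing k] [Monoid G]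
    (R : Subalgebra ℤ k) (x : MonoidAlgebra k G) (hx : ∀ g, x.coeff g ∈ R) :
    ∃ y : MonoidAlgebra R G, mapRingHom G (R.val : R →+* k) y = x := by
  classical
  refine ⟨ofCoeff (x.coeff.mapRange (fun r => if h : r ∈ R then ⟨r, h⟩ else 0) ?_), ?_⟩
  · exact dif_pos R.zero_mem
  · ext g
    simp [hx g]

/-- If `G` is surjunctive and `k` is a field, the group ring `k[G]` is
directly finite. -/
theorem groupRing_directly_finite {G : Type} [Group G] (hG : Surjunctive G)
    {k : Type} [Field k] (a b : MonoidAlgebra k G)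
    (h : a * b = 1) : b * a = 1 := by
  classical
  by_contra hne
  obtain ⟨g, hg⟩ : ∃ g, (b * a - 1).coeff g ≠ 0 := by
    by_contra! h0
    exact hne (sub_eq_zero.mp (MonoidAlgebra.ext (Finsupp.ext h0)))
  set r := (b * a - 1).coeff g with hr
  let S : Finset k := a.coeff.support.image a.coeff ∪ b.coeff.support.image b.coeff ∪ {r⁻¹}
  let R : Subalgebra ℤ k := Algebra.adjoin ℤ (S : Set k)
  have hfin : Algebra.FiniteType ℤ R := R.fg_iff_finiteType.mp ⟨S, rfl⟩
  have hS : ∀ s ∈ S, s ∈ R := fun s hs => Algebra.subset_adjoin hs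
  have hmem (x : MonoidAlgebra k G) (hx : x.coeff.support.image x.coeff ⊆ S) (m : G) :
      x.coeff m ∈ R := by
    by_cases hm : x.coeff m = 0
    · rw [hm]
      exact R.zero_mem
    · exact hS _ (hx (Finset.mem_image_of_mem _ (Finsupp.mem_support_iff.mpr hm)))
  obtain ⟨a₀, ha₀⟩ := MonoidAlgebra.exists_mapRingHom_subtype_eq R a
    (hmem a (by grind))
  obtain ⟨b₀, hb₀⟩ := MonoidAlgebra.exists_mapRingHom_subtype_eq R b
    (hmem b (by grind))
  have h₀ : a₀ * b₀ = 1 := by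
    ext m
    rw [← ha₀, ← hb₀, ← map_mul, ← map_one (MonoidAlgebra.mapRingHom G (R.val : R →+* k))] at h
    have hm := congrArg (fun x : MonoidAlgebra k G => x.coeff m) h
    simp only [MonoidAlgebra.coeff_mapRingHom] at hm
    exact hm
  have hr₀ : ((b₀ * a₀ - 1).coeff g : k) = r := by
    rw [hr, ← ha₀, ← hb₀, ← map_mul,
      ← map_one (MonoidAlgebra.mapRingHom G (R.val : R →+* k)), ← map_sub,
      MonoidAlgebra.coeff_mapRingHom]
    rfl
  have hunit : IsUnit ((b₀ * a₀ - 1).coeff g) := by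
    refine .of_mul_eq_one ⟨r⁻¹, hS _ (by grind)⟩ (Subtype.ext ?_)
    simp only [MulMemClass.coe_mul, hr₀, OneMemClass.coe_one]
    exact mul_inv_cancel₀ hg
  obtain ⟨I, hI⟩ := Ideal.exists_maximal R
  let _ : Field (R ⧸ I) := Ideal.Quotient.field I
  have : Algebra.FiniteType ℤ (R ⧸ I) :=
    hfin.of_surjective (Ideal.Quotient.mkₐ ℤ I) Ideal.Quotient.mk_surjective
  have : Finite (R ⧸ I) := Field.finite_of_finiteType_int (R ⧸ I)
  let φ := MonoidAlgebra.mapRingHom G (Ideal.Quotient.mk I)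
  have hφ : φ b₀ * φ a₀ = 1 :=
    hG.mul_eq_one_symm_of_finite (by rw [← map_mul, h₀, map_one])
  have hzero : φ (b₀ * a₀ - 1) = 0 := by rw [map_sub, map_mul, hφ, map_one, sub_self]
  refine (hunit.map (Ideal.Quotient.mk I)).ne_zero ?_
  rw [← MonoidAlgebra.coeff_mapRingHom]
  exact congrArg (fun x : MonoidAlgebra (R ⧸ I) G => x.coeff g) hzero
end

section
/- If G is a surjunctive group and k is any field, then the group ring k[G] is stably finite: for every n ≥ 1 and all A, B ∈ Mat_n(k[G]), AB = 1 implies BA = 1. -/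
/-- The `R`-linear endomorphism `c ↦ c (· * g)` of `G → R`. -/
def translationEnd (R G : Type*) [CommRing R] [Group G] : G →* Module.End R (G → R) where
  toFun g := LinearMap.funLeft R R (· * g)
  map_one' := by ext; simp [LinearMap.funLeft]
  map_mul' g h := by
    refine LinearMap.ext fun c => funext fun x => ?_
    simp [LinearMap.funLeft_apply, mul_assoc]

/-- The action of the group ring on configurations by right translations. -/
noncomputable def groupRingAction (R G : Type*) [CommRing R] [Group G] :
    MonoidAlgebra R G →ₐ[R] Module.End R (G → R) :=
  MonoidAlgebra.lift R (Module.End R (G → R)) G (translationEnd R G)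

section GroupRingAction

variable {R G : Type*} [CommRing R] [Group G]

theorem groupRingAction_apply (a : MonoidAlgebra R G) (c : G → R) (g : G) :
    groupRingAction R G a c g = a.coeff.sum fun m r => r * c (g * m) := by
  simp [groupRingAction, MonoidAlgebra.lift_apply, translationEnd, Finsupp.sum,
    LinearMap.sum_apply, Finset.sum_apply, LinearMap.funLeft_apply]

theorem groupRingAction_apply_eq_sum (a : MonoidAlgebra R G) {M : Finset G}
    (hM : a.coeff.support ⊆ M) (c : G → R) (g : G) :
    groupRingAction R G a c g = ∑ m ∈ M, a.coeff m * c (g * m) := by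
  rw [groupRingAction_apply]
  exact Finsupp.sum_of_support_subset _ hM _ (by simp)

theorem groupRingAction_injective : Function.Injective (groupRingAction R G) := by
  classical
  intro a b hab
  ext m
  have h (x : MonoidAlgebra R G) :
      groupRingAction R G x (Pi.single m 1) 1 = x.coeff m := by
    rw [groupRingAction_apply]
    simp only [one_mul, Pi.single_apply, mul_ite, mul_one, mul_zero]
    rw [Finsupp.sum_ite_self_eq']
  rw [← h a, ← h b, hab]

/-- The action of a matrix over the group ring on vector-valued configurations. -/
noncomputable def matrixAction {n : ℕ} (A : Matrix (Fin n) (Fin n) (MonoidAlgebra R G))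
    (c : G → Fin n → R) : G → Fin n → R :=
  fun g i => ∑ j, groupRingAction R G (A i j) (fun x => c x j) g

theorem matrixAction_mul {n : ℕ} (A B : Matrix (Fin n) (Fin n) (MonoidAlgebra R G))
    (c : G → Fin n → R) :
    matrixAction (A * B) c = matrixAction A (matrixAction B c) := by
  funext g i
  have h (j : Fin n) : (fun x => matrixAction B c x j) =
      ∑ l, groupRingAction R G (B j l) (fun x => c x l) := by
    funext x
    simp [matrixAction]
  simp only [matrixAction, Matrix.mul_apply, map_sum, map_mul, LinearMap.sum_apply,
    Finset.sum_apply, Module.End.mul_apply] at h ⊢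
  simp only [h, map_sum, Finset.sum_apply]
  exact Finset.sum_comm

theorem matrixAction_one {n : ℕ} (c : G → Fin n → R) :
    matrixAction (1 : Matrix (Fin n) (Fin n) (MonoidAlgebra R G)) c = c := by
  funext g i
  rw [matrixAction, Finset.sum_eq_single i]
  · simp
  · intro j _ hj
    simp [Matrix.one_apply_ne' hj]
  · simp

theorem matrixAction_injective {n : ℕ} :
    Function.Injective (matrixAction (R := R) (G := G) (n := n)) := by
  classical
  intro A B hAB
  ext1 i j
  refine groupRingAction_injective (LinearMap.ext fun c => funext fun g => ?_)
  have h (A : Matrix (Fin n) (Fin n) (MonoidAlgebra R G)) :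
      matrixAction A (fun x => Pi.single j (c x)) g i = groupRingAction R G (A i j) c g := by
    rw [matrixAction, Finset.sum_eq_single j]
    · simp
    · intro l _ hl
      have : (fun x => (Pi.single j (c x) : Fin n → R) l) = 0 := by
        funext x
        simp [hl]
      rw [this, map_zero, Pi.zero_apply]
    · simp
  rw [← h A, ← h B, hAB]

end GroupRingAction

theorem isCellularAutomaton_matrixAction {R G : Type} [CommRing R] [Group G] {n : ℕ}
    (A : Matrix (Fin n) (Fin n) (MonoidAlgebra R G)) :
    IsCellularAutomaton G (Fin n → R) (matrixAction A) := by
  classical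
  let M : Finset G := Finset.univ.biUnion fun p : Fin n × Fin n => (A p.1 p.2).coeff.support
  refine ⟨M, fun f i => ∑ j, ∑ m : M, (A i j).coeff m * f m j, fun c g => funext fun i => ?_⟩
  refine Finset.sum_congr rfl fun j _ => ?_
  have hM : (A i j).coeff.support ⊆ M :=
    Finset.subset_biUnion_of_mem (fun p : Fin n × Fin n => (A p.1 p.2).coeff.support)
      (Finset.mem_univ (i, j))
  rw [groupRingAction_apply_eq_sum _ hM]
  exact (Finset.sum_coe_sort M fun m => (A i j).coeff m * c (g * m) j).symm

theorem Surjunctive.mul_eq_one_of_finite {R G : Type} [CommRing R] [Finite R] [Group G]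
    (hG : Surjunctive G) {n : ℕ} {A B : Matrix (Fin n) (Fin n) (MonoidAlgebra R G)}
    (h : A * B = 1) : B * A = 1 := by
  have hleft : Function.LeftInverse (matrixAction A) (matrixAction B) := fun c => by
    rw [← matrixAction_mul, h, matrixAction_one]
  have hright := hleft.rightInverse_of_surjective
    (hG _ _ (isCellularAutomaton_matrixAction B) hleft.injective)
  refine matrixAction_injective (funext fun c => ?_)
  rw [matrixAction_mul, matrixAction_one, hright]

theorem finite_of_module_finite_int (K : Type*) [Field K] [Module.Finite ℤ K] : Finite K := by
  have hK : ¬ CharZero K := fun _ =>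
    Int.not_isField (isField_of_isIntegral_of_isField (RingHom.injective_int (algebraMap ℤ K))
      (Field.toIsField K))
  obtain ⟨p, _⟩ := CharP.exists K
  have hp : p ≠ 0 := by
    rintro rfl
    exact hK (CharP.charP_to_charZero K)
  refine Module.finite_of_fg_torsion K fun x =>
    ⟨⟨(p : ℤ), mem_nonZeroDivisors_of_ne_zero (by exact_mod_cast hp)⟩, ?_⟩
  simp [Submonoid.smul_def]

/-- A nontrivial commutative ring of finite type over `ℤ` has a finite residue field. -/
theorem exists_isMaximal_finite_quotient (R : Type*) [CommRing R] [Nontrivial R]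
    [Algebra.FiniteType ℤ R] : ∃ I : Ideal R, I.IsMaximal ∧ Finite (R ⧸ I) := by
  obtain ⟨I, hI⟩ := Ideal.exists_maximal R
  refine ⟨I, hI, ?_⟩
  let := Ideal.Quotient.field I
  have : Algebra.FiniteType ℤ (R ⧸ I) := inferInstance
  have := Int.isJacobsonRing
  have := finite_of_finite_type_of_isJacobsonRing ℤ (R ⧸ I)
  exact finite_of_module_finite_int (R ⧸ I)

theorem MonoidAlgebra.exists_mapRingHom_subtype_eq_s5 {k G : Type*} [CommRing k] [Monoid G]
    (S : Subalgebra ℤ k) (a : MonoidAlgebra k G) (ha : ∀ g, a.coeff g ∈ S) :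
    ∃ b : MonoidAlgebra S G, MonoidAlgebra.mapRingHom G S.toSubring.subtype b = a := by
  classical
  refine ⟨.ofCoeff (Finsupp.onFinset a.coeff.support (fun g => ⟨a.coeff g, ha g⟩) ?_), ?_⟩
  · intro g hg
    rw [Finsupp.mem_support_iff]
    exact fun h0 => hg (Subtype.ext h0)
  · ext g
    rw [MonoidAlgebra.coeff_mapRingHom]
    rfl

/-- If `G` is surjunctive and `k` is a field, the group ring `k[G]` is stably
finite: for every `n ≥ 1`, `Mat_n(k[G])` is directly finite. -/
theorem groupRing_stably_finite {G : Type} [Group G] (hG : Surjunctive G)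
    {k : Type} [Field k] (n : ℕ) (hn : 1 ≤ n)
    (A B : Matrix (Fin n) (Fin n) (MonoidAlgebra k G))
    (h : A * B = 1) : B * A = 1 := by
  classical
  by_contra hBA
  obtain ⟨i, j, g, hr⟩ : ∃ i j g, ((B * A - 1) i j).coeff g ≠ 0 := by
    by_contra! hzero
    exact hBA (sub_eq_zero.mp (by ext i j g; simpa using hzero i j g))
  set r := ((B * A - 1) i j).coeff g with hr_def
  let coeffs (C : Matrix (Fin n) (Fin n) (MonoidAlgebra k G)) : Set k :=
    ⋃ p : Fin n × Fin n, Set.range (C p.1 p.2).coeff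
  let s : Set k := insert r⁻¹ (coeffs A ∪ coeffs B)
  have hcoeffs (C) : (coeffs C).Finite := Set.finite_iUnion fun p => Finsupp.finite_range _
  have hs : s.Finite := ((hcoeffs A).union (hcoeffs B)).insert _
  let S := Algebra.adjoin ℤ s
  have : Algebra.FiniteType ℤ S := .adjoin_of_finite hs
  have mem_coeffs (C) (i j g) : (C i j).coeff g ∈ coeffs C :=
    Set.mem_iUnion_of_mem (i, j) ⟨g, rfl⟩
  let φ : MonoidAlgebra S G →+* MonoidAlgebra k G :=
    MonoidAlgebra.mapRingHom G S.toSubring.subtype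
  have hφ : Function.Injective φ := fun a b hab => by
    ext g
    have := congrArg (fun x => x.coeff g) hab
    simpa [φ] using this
  have lift_matrix (C) (hC : coeffs C ⊆ s) : ∃ C', φ.mapMatrix C' = C := by
    choose f hf using fun i j => MonoidAlgebra.exists_mapRingHom_subtype_eq_s5 S (C i j)
      fun g => Algebra.subset_adjoin (hC (mem_coeffs C i j g))
    exact ⟨Matrix.of f, by ext1 i j; exact hf i j⟩
  obtain ⟨A', hA⟩ := lift_matrix A fun x hx => .inr (.inl hx)
  obtain ⟨B', hB⟩ := lift_matrix B fun x hx => .inr (.inr hx)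
  have hAB' : A' * B' = 1 := by
    refine Matrix.map_injective hφ ?_
    change φ.mapMatrix (A' * B') = φ.mapMatrix 1
    rw [map_mul, hA, hB, h, map_one]
  obtain ⟨I, hI, _⟩ := exists_isMaximal_finite_quotient S
  let ψ : MonoidAlgebra S G →+* MonoidAlgebra (S ⧸ I) G :=
    MonoidAlgebra.mapRingHom G (Ideal.Quotient.mk I)
  have hBA' : ψ.mapMatrix (B' * A' - 1) = 0 := by
    rw [map_sub, map_mul, map_one, sub_eq_zero]
    exact hG.mul_eq_one_of_finite (by rw [← map_mul, hAB', map_one])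
  let r' : S := ((B' * A' - 1) i j).coeff g
  have hr' : (r' : k) = r := by
    have : φ.mapMatrix (B' * A' - 1) = B * A - 1 := by
      rw [map_sub, map_mul, map_one, hA, hB]
    rw [hr_def, ← this]
    exact (MonoidAlgebra.coeff_mapRingHom S.toSubring.subtype
      ((B' * A' - 1) i j) g).symm
  have hrI : r' ∈ I := by
    rw [← Ideal.Quotient.eq_zero_iff_mem]
    have := congrArg (fun C => (C i j).coeff g) hBA'
    exact (MonoidAlgebra.coeff_mapRingHom (Ideal.Quotient.mk I) _ g).symm.trans this
  refine hI.ne_top (I.eq_top_of_isUnit_mem hrI (.of_mul_eq_one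
    ⟨r⁻¹, Algebra.subset_adjoin (Set.mem_insert _ _)⟩ (Subtype.ext ?_)))
  change (r' : k) * r⁻¹ = 1
  rw [hr', mul_inv_cancel₀ hr]
end

section
/- Every sofic group is surjunctive: if G is sofic and A is a finite set, then every injective cellular automaton τ : A^G → A^G is surjective (Gromov–Weiss theorem). -/
/-- A group `G` is sofic if for every finite subset `F ⊆ G` and `ε > 0` there
is an `(F, ε)`-almost homomorphism `φ : G → Sym(n)` for some `n ≥ 1`:
`φ` is almost multiplicative on `F` and almost free on `F`. -/
def Sofic (G : Type) [Group G] : Prop :=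
  ∀ (F : Finset G) (ε : ℝ), 0 < ε →
    ∃ (n : ℕ), 0 < n ∧ ∃ φ : G → Equiv.Perm (Fin n),
      (∀ g ∈ F, ∀ h ∈ F,
        ((Finset.univ.filter fun i : Fin n => φ (g * h) i ≠ φ g (φ h i)).card : ℝ)
          ≤ ε * n) ∧
      (∀ g ∈ F, ∀ h ∈ F, g ≠ h →
        ((Finset.univ.filter fun i : Fin n => φ g i = φ h i).card : ℝ) ≤ ε * n)

theorem IsCellularAutomaton.continuous {G A : Type} [Group G] [TopologicalSpace A]
    [DiscreteTopology A] {τ : (G → A) → (G → A)}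
    (hτ : IsCellularAutomaton G A τ) : Continuous τ := by
  obtain ⟨M, μ, h⟩ := hτ
  refine continuous_pi fun g => ?_
  simp only [h]
  exact (continuous_of_discreteTopology (f := μ)).comp
    (continuous_pi fun m => continuous_apply _)

/-- Injectivity of a continuous map is witnessed by finitely many coordinates: each coordinate of
the argument is determined by finitely many coordinates of the image. -/
theorem Continuous.exists_finset_determining_apply {I J A : Type*} [Finite A]
    [TopologicalSpace A] [DiscreteTopology A] {τ : (I → A) → (J → A)} (hτ : Continuous τ)
    (hinj : Function.Injective τ) (i : I) :
    ∃ N : Finset J, ∀ c c', (∀ j ∈ N, τ c j = τ c' j) → c i = c' i := by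
  have hcl : IsCompact {p : (I → A) × (I → A) | p.1 i ≠ p.2 i} := by
    refine IsClosed.isCompact ?_
    exact (isClosed_discrete {q : A × A | q.1 ≠ q.2}).preimage
      (f := fun p : (I → A) × (I → A) => (p.1 i, p.2 i)) (by fun_prop)
  obtain ⟨N, hN⟩ := hcl.elim_finite_subcover
    (fun j => {p : (I → A) × (I → A) | τ p.1 j ≠ τ p.2 j})
    (fun j => (isOpen_discrete {q : A × A | q.1 ≠ q.2}).preimage
      (f := fun p : (I → A) × (I → A) => (τ p.1 j, τ p.2 j)) (by fun_prop))
    (by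
      rintro ⟨c, c'⟩ hp
      by_contra hc
      simp only [Set.mem_iUnion, Set.mem_ofPred_eq, not_exists, not_not] at hc
      exact hp (congrFun (hinj (funext hc)) i))
  refine ⟨N, fun c c' h => ?_⟩
  by_contra hc
  obtain ⟨j, hj, hne⟩ := Set.mem_iUnion₂.1 (hN (show (c, c') ∈ _ from hc))
  exact hne (h j hj)

/-- A point outside the range of a continuous map is already separated from the range by finitely
many coordinates. -/
theorem Continuous.exists_finset_forall_apply_ne {I J A : Type*} [Finite A]
    [TopologicalSpace A] [DiscreteTopology A] {τ : (I → A) → (J → A)} (hτ : Continuous τ)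
    {y : J → A} (hy : y ∉ Set.range τ) :
    ∃ Ω : Finset J, ∀ c, ∃ j ∈ Ω, τ c j ≠ y j := by
  obtain ⟨Ω, hΩ⟩ := (isCompact_univ (X := I → A)).elim_finite_subcover
    (fun j => {c : I → A | τ c j ≠ y j})
    (fun j => (isOpen_discrete {a : A | a ≠ y j}).preimage
      (f := fun c : I → A => τ c j) (by fun_prop))
    (by
      intro c _
      by_contra hc
      simp only [Set.mem_iUnion, Set.mem_ofPred_eq, not_exists, not_not] at hc
      exact hy ⟨c, funext hc⟩)
  refine ⟨Ω, fun c => ?_⟩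
  obtain ⟨j, hj, hne⟩ := Set.mem_iUnion₂.1 (hΩ (Set.mem_univ c))
  exact ⟨j, hj, hne⟩

/-- A maximal subset of `P` whose translates under finitely many permutations are disjoint has
cardinality at least a fixed proportion of that of `P`. -/
theorem Finset.exists_separated_subset {V Ω : Type*} [Fintype Ω] [Nonempty Ω]
    (π : Ω → Equiv.Perm V) (P : Finset V) :
    ∃ W ⊆ P, (∀ v ∈ W, ∀ w ∈ W, ∀ a b, π a v = π b w → v = w) ∧
      P.card ≤ Fintype.card Ω ^ 2 * W.card := by
  classical
  obtain ⟨W, hW⟩ := Set.Finite.exists_maximal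
    (s := {W | W ⊆ P ∧ ∀ v ∈ W, ∀ w ∈ W, ∀ a b, π a v = π b w → v = w})
    (P.powerset.finite_toSet.subset fun W hW => by simpa using hW.1) ⟨∅, by simp⟩
  have hmem := hW.prop
  refine ⟨W, hmem.1, hmem.2, ?_⟩
  have hsub : P ⊆ (W ×ˢ (Finset.univ : Finset (Ω × Ω))).image
      (fun p => (π p.2.1).symm (π p.2.2 p.1)) := by
    intro v hv
    suffices h : ∃ w ∈ W, ∃ a b, π a v = π b w by
      obtain ⟨w, hw, a, b, hab⟩ := h
      exact Finset.mem_image.2 ⟨(w, a, b), by simp [hw], by simp [← hab]⟩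
    by_contra! hc
    have hle := hW.le_of_ge (y := insert v W) (by
      refine ⟨Finset.insert_subset hv hmem.1, ?_⟩
      intro x hx z hz a b hab
      rw [Finset.mem_insert] at hx hz
      rcases hx with rfl | hx <;> rcases hz with rfl | hz
      · rfl
      · exact (hc z hz a b hab).elim
      · exact (hc x hx b a hab.symm).elim
      · exact hmem.2 x hx z hz a b hab) (Finset.subset_insert _ _)
    have a := Classical.arbitrary Ω
    exact hc v (hle (Finset.mem_insert_self _ _)) a a rfl
  calc P.card ≤ _ := Finset.card_le_card hsub
    _ ≤ _ := Finset.card_image_le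
    _ = _ := by simp [Finset.card_product]; ring

/-- If a self-map of `V → A` determines its argument on `P`, and its values avoid the pattern `y`
at each of a family of disjoint windows indexed by `W`, then `P` cannot be too large. -/
theorem card_pow_le_of_avoids_pattern {V A Ω : Type*} [Fintype V] [Fintype A] [Nonempty A]
    [Fintype Ω] (Φ : (V → A) → (V → A)) (P W : Finset V)
    (hP : ∀ x x', Φ x = Φ x' → ∀ v ∈ P, x v = x' v) (e : W × Ω → V)
    (he : Function.Injective e) (y : Ω → A) (hy : ∀ x w, ∃ a, Φ x (e (w, a)) ≠ y a) :
    Fintype.card A ^ P.card ≤ (Fintype.card A ^ Fintype.card Ω - 1) ^ W.card *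
      Fintype.card A ^ (Fintype.card V - W.card * Fintype.card Ω) := by
  classical
  let ext : (P → A) → V → A := fun x v => if h : v ∈ P then x ⟨v, h⟩ else Classical.arbitrary A
  let f : (P → A) → (W → {p : Ω → A // p ≠ y}) × ({v // v ∉ Set.range e} → A) := fun x =>
    (fun w => ⟨fun a => Φ (ext x) (e (w, a)), fun h => by
      obtain ⟨a, ha⟩ := hy (ext x) w
      exact ha (congrFun h a)⟩, fun v => Φ (ext x) v)
  have hf : Function.Injective f := by
    intro x x' h
    have hΦ : Φ (ext x) = Φ (ext x') := by
      funext v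
      by_cases hv : v ∈ Set.range e
      · obtain ⟨⟨w, a⟩, rfl⟩ := hv
        exact congrFun (congrArg Subtype.val (congrFun (congrArg Prod.fst h) w)) a
      · exact congrFun (congrArg Prod.snd h) ⟨v, hv⟩
    funext ⟨v, hv⟩
    simpa [ext, hv] using hP _ _ hΦ v hv
  have hR : Fintype.card {v // v ∉ Set.range e} =
      Fintype.card V - W.card * Fintype.card Ω := by
    rw [Fintype.card_subtype_compl]
    congr 1
    rw [← Fintype.card_coe W, ← Fintype.card_prod]
    exact Set.card_range_of_injective he
  have hp : Fintype.card {p : Ω → A // p ≠ y} = Fintype.card A ^ Fintype.card Ω - 1 := by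
    rw [← Fintype.card_fun, ← Set.card_ne_eq y]
    rfl
  have := Fintype.card_le_of_injective f hf
  rwa [Fintype.card_prod, Fintype.card_fun, Fintype.card_fun, Fintype.card_fun, hR, hp,
    Fintype.card_coe, Fintype.card_coe] at this

theorem Nat.exists_mul_sub_one_pow_lt (q : ℕ) {m : ℕ} (hm : 0 < m) :
    ∃ k, q * (m - 1) ^ k < m ^ k := by
  rcases Nat.eq_zero_or_pos q with rfl | hq
  · exact ⟨0, by simp⟩
  have hm' : (0 : ℝ) < m := by exact_mod_cast hm
  have hq' : (0 : ℝ) < q := by exact_mod_cast hq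
  obtain ⟨k, hk⟩ := exists_pow_lt_of_lt_one (inv_pos.2 hq')
    (show ((m - 1 : ℕ) : ℝ) / m < 1 by
      rw [div_lt_one hm']
      exact_mod_cast Nat.sub_lt hm one_pos)
  refine ⟨k, ?_⟩
  rw [div_pow, div_lt_iff₀ (by positivity), inv_mul_eq_div, lt_div_iff₀ hq'] at hk
  rw [mul_comm]
  exact_mod_cast hk

theorem Nat.pow_mul_sub_one_pow_lt {q m k b w : ℕ} (hm : 0 < m)
    (hk : q * (m - 1) ^ k < m ^ k) (hw : 0 < w) (hkw : k * b ≤ w) :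
    q ^ b * (m - 1) ^ w < m ^ w := by
  obtain ⟨r, rfl⟩ := Nat.exists_eq_add_of_le hkw
  have h1 : q ^ b * (m - 1) ^ (k * b + r) = (q * (m - 1) ^ k) ^ b * (m - 1) ^ r := by ring
  have h2 : m ^ (k * b + r) = (m ^ k) ^ b * m ^ r := by ring
  rw [h1, h2]
  rcases Nat.eq_zero_or_pos b with rfl | hb
  · simpa using Nat.pow_lt_pow_left (Nat.sub_lt hm one_pos) (by omega : r ≠ 0)
  · exact Nat.mul_lt_mul_of_lt_of_le (Nat.pow_lt_pow_left hk hb.ne')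
      (Nat.pow_le_pow_left (Nat.sub_le _ _) _) (by positivity)

/-- In a sofic approximation, most points see an exact copy of the given finite set. -/
theorem Sofic.exists_card_bad_mul_le {G : Type} [Group G] (hG : Sofic G) (E : Finset G) (D : ℕ) :
    ∃ n : ℕ, 0 < n ∧ ∃ (φ : G → Equiv.Perm (Fin n)) (P : Finset (Fin n)),
      (∀ v ∈ P, ∀ g ∈ E, ∀ h ∈ E,
        φ (g * h) v = φ g (φ h v) ∧ (φ g v = φ h v → g = h)) ∧
      Pᶜ.card * D ≤ n := by
  classical
  set K : ℝ := 2 * E.card ^ 2 * D + 1 with hK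
  have hKpos : 0 < K := by positivity
  obtain ⟨n, hn, φ, hmul, hfree⟩ := hG E K⁻¹ (inv_pos.2 hKpos)
  refine ⟨n, hn, φ, Finset.univ.filter fun v => ∀ g ∈ E, ∀ h ∈ E,
    φ (g * h) v = φ g (φ h v) ∧ (φ g v = φ h v → g = h), by simp, ?_⟩
  set B := (Finset.univ.filter fun v => ∀ g ∈ E, ∀ h ∈ E,
    φ (g * h) v = φ g (φ h v) ∧ (φ g v = φ h v → g = h))ᶜ with hB
  have hsub : B ⊆ (E ×ˢ E).biUnion fun p =>
      (Finset.univ.filter fun i : Fin n => φ (p.1 * p.2) i ≠ φ p.1 (φ p.2 i)) ∪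
      (Finset.univ.filter fun i : Fin n => p.1 ≠ p.2 ∧ φ p.1 i = φ p.2 i) := by
    intro v hv
    simp only [hB, Finset.mem_compl, Finset.mem_filter, Finset.mem_univ, true_and] at hv
    simp only [Finset.mem_biUnion, Finset.mem_product, Finset.mem_union, Finset.mem_filter,
      Finset.mem_univ, true_and, Prod.exists]
    by_contra! hc
    exact hv fun g hg h hh => ⟨(hc g h ⟨hg, hh⟩).1, fun heq => by
      by_contra hne
      exact (hc g h ⟨hg, hh⟩).2 hne heq⟩
  have hcard : (B.card : ℝ) ≤ E.card ^ 2 * (2 * (K⁻¹ * n)) := by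
    have h1 := (Finset.card_le_card hsub).trans Finset.card_biUnion_le
    have h2 : (B.card : ℝ) ≤ ∑ p ∈ E ×ˢ E, (2 * (K⁻¹ * n)) := by
      refine (Nat.cast_le.2 h1).trans ?_
      push_cast
      refine Finset.sum_le_sum fun p hp => ?_
      obtain ⟨hg, hh⟩ := Finset.mem_product.1 hp
      have h3 := hmul _ hg _ hh
      have h4 : ((Finset.univ.filter fun i : Fin n =>
          p.1 ≠ p.2 ∧ φ p.1 i = φ p.2 i).card : ℝ) ≤ K⁻¹ * n := by
        by_cases hne : p.1 = p.2
        · simp only [hne, ne_eq, not_true_eq_false, false_and, Finset.filter_false,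
            Finset.card_empty, Nat.cast_zero]
          positivity
        · simpa [hne] using hfree _ hg _ hh hne
      refine (Nat.cast_le.2 (Finset.card_union_le _ _)).trans ?_
      push_cast
      linarith
    simpa [Finset.sum_const, Finset.card_product, sq] using h2
  have hD : (B.card : ℝ) * D ≤ n := by
    calc (B.card : ℝ) * D ≤ E.card ^ 2 * (2 * (K⁻¹ * n)) * D := by gcongr
      _ = (K - 1) * (K⁻¹ * n) := by rw [hK]; ring
      _ ≤ K * (K⁻¹ * n) := by gcongr; linarith
      _ = n := by field_simp
  exact_mod_cast hD

/-- Gromov–Weiss: every sofic group is surjunctive. -/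
theorem sofic_implies_surjunctive {G : Type} [Group G] (hG : Sofic G)
    (A : Type) [Finite A] (τ : (G → A) → (G → A))
    (hτ : IsCellularAutomaton G A τ) (hinj : Function.Injective τ) :
    Function.Surjective τ := by
  classical
  intro y
  by_contra hy
  have : Nonempty A := ⟨y 1⟩
  have := Fintype.ofFinite A
  let : TopologicalSpace A := ⊥
  have : DiscreteTopology A := ⟨rfl⟩
  obtain ⟨N, hN⟩ := hτ.continuous.exists_finset_determining_apply hinj 1
  obtain ⟨Ω, hΩ⟩ := hτ.continuous.exists_finset_forall_apply_ne hy
  obtain ⟨M, μ, hμ⟩ := hτ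
  have : Nonempty Ω := by
    obtain ⟨g, hg, -⟩ := hΩ y
    exact ⟨⟨g, hg⟩⟩
  have hqs : 0 < Fintype.card A ^ Ω.card := pow_pos Fintype.card_pos _
  obtain ⟨k, hk⟩ := Nat.exists_mul_sub_one_pow_lt (Fintype.card A) hqs
  obtain ⟨n, hn, φ, P, hP, hb⟩ := hG.exists_card_bad_mul_le
    ((insert 1 (M ∪ N ∪ Ω)).image (·⁻¹)) (Ω.card ^ 2 * k + 2)
  have hmem : ∀ g ∈ insert 1 (M ∪ N ∪ Ω), g⁻¹ ∈ (insert 1 (M ∪ N ∪ Ω)).image (·⁻¹) :=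
    fun g hg => Finset.mem_image_of_mem _ hg
  let Φ : (Fin n → A) → (Fin n → A) := fun x v => μ fun m => x (φ (m : G)⁻¹ v)
  have hΦ : ∀ x, ∀ v ∈ P, ∀ g ∈ N ∪ Ω, Φ x (φ g⁻¹ v) = τ (fun g => x (φ g⁻¹ v)) g := by
    intro x v hv g hg
    rw [hμ]
    refine congrArg μ (funext fun m => ?_)
    have hm := m.2
    rw [mul_inv_rev, (hP v hv _ (hmem m (by simp [hm])) _
      (hmem g (by simp at hg ⊢; tauto))).1]
  have hdet : ∀ x x', Φ x = Φ x' → ∀ v ∈ P, x v = x' v := by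
    intro x x' h v hv
    have h1 : φ 1 v = v := by
      have := (hP v hv _ (hmem 1 (by simp)) _ (hmem 1 (by simp))).1
      rw [inv_one, one_mul] at this
      exact ((φ 1).injective this).symm
    have := hN (fun g => x (φ g⁻¹ v)) (fun g => x' (φ g⁻¹ v)) fun g hg => by
      rw [← hΦ x v hv g (by simp [hg]), ← hΦ x' v hv g (by simp [hg]), h]
    simpa [h1] using this
  obtain ⟨W, hWP, hsep, hPW⟩ := P.exists_separated_subset (fun a : Ω => φ (a : G)⁻¹)
  let e : W × Ω → Fin n := fun p => φ (p.2 : G)⁻¹ p.1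
  have he : Function.Injective e := by
    rintro ⟨⟨v, hv⟩, a, ha⟩ ⟨⟨w, hw⟩, b, hb⟩ h
    obtain rfl := hsep v hv w hw ⟨a, ha⟩ ⟨b, hb⟩ h
    have := (hP v (hWP hv) _ (hmem a (by simp [ha])) _ (hmem b (by simp [hb]))).2 h
    simpa using this
  have hcount := card_pow_le_of_avoids_pattern Φ P W hdet e he (fun a => y a) fun x w => by
    obtain ⟨g, hg, hne⟩ := hΩ fun g => x (φ g⁻¹ w)
    refine ⟨⟨g, hg⟩, ?_⟩
    rwa [← hΦ x w (hWP w.2) g (by simp [hg])] at hne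
  have hWn := Fintype.card_le_of_injective e he
  have hPn := P.card_add_card_compl
  simp only [Fintype.card_prod, Fintype.card_coe, Fintype.card_fin] at hcount hWn hPn hPW
  set b := Pᶜ.card
  have hs : 0 < Ω.card := Finset.card_pos.2 (Finset.nonempty_coe_sort.1 ‹_›)
  have hle : Ω.card ^ 2 * (k * b) + b ≤ Ω.card ^ 2 * W.card + b := by nlinarith
  have hkw : k * b ≤ W.card := Nat.le_of_mul_le_mul_left (by omega) (pow_pos hs 2)
  have hw : 0 < W.card := by
    rcases Nat.eq_zero_or_pos W.card with h0 | h0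
    · rw [h0, mul_zero] at hPW
      nlinarith [Nat.zero_le (b * (Ω.card ^ 2 * k))]
    · exact h0
  have hlt := Nat.pow_mul_sub_one_pow_lt hqs hk hw hkw
  set q := Fintype.card A
  have hq : 0 < q := Fintype.card_pos
  refine absurd hcount (not_le.2 (Nat.lt_of_mul_lt_mul_left (a := q ^ b) ?_))
  calc q ^ b * ((q ^ Ω.card - 1) ^ W.card * q ^ (n - W.card * Ω.card))
      = q ^ b * (q ^ Ω.card - 1) ^ W.card * q ^ (n - W.card * Ω.card) := by ring
    _ < (q ^ Ω.card) ^ W.card * q ^ (n - W.card * Ω.card) := by gcongr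
    _ = q ^ n := by rw [← pow_mul, ← pow_add]; congr 1; rw [mul_comm]; omega
    _ = q ^ b * q ^ P.card := by rw [← pow_add]; congr 1; omega
end
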